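/- arXiv:2002.06335 — 8 statements merged into one kernel-verified Lean document; each statement's English description precedes it below -/
import Mathlib

section
/- Along every solution of the equations of motion satisfying the contact constraint (v+ω×r, γ)=0 for all t, the energy E = ½(ω, I·ω) + ½·m·(v,v) + m·g·a·γ₃ evolves according to dE/dt = (F, v) + (M_f, ω), for arbitrary resistance force F(t), rolling resistance torque M_f(t) and normal reaction N(t). -/
open Matrix

noncomputable section

/-- Cross product on ℝ³. -/
def cross3 (u v : Fin 3 → ℝ) : Fin 3 → ℝ :=
  ![u 1 * v 2 - u 2 * v 1, u 2 * v 0 - u 0 * v 2, u 0 * v 1 - u 1 * v 0]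

/-- Action of the axisymmetric inertia tensor I = diag(i₁,i₁,i₃). -/
def inert (i₁ i₃ : ℝ) (w : Fin 3 → ℝ) : Fin 3 → ℝ := ![i₁ * w 0, i₁ * w 1, i₃ * w 2]

/-- The inertia form `w ↦ (w, I w)` differentiates like a symmetric quadratic form. -/
lemma HasDerivAt.dotProduct_inert (i₁ i₃ : ℝ) {w : ℝ → Fin 3 → ℝ} {w' : Fin 3 → ℝ} {t : ℝ}
    (hw : HasDerivAt w w' t) :
    HasDerivAt (fun s => w s ⬝ᵥ inert i₁ i₃ (w s)) (2 * (w t ⬝ᵥ inert i₁ i₃ w')) t := by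
  have h := hasDerivAt_pi.1 hw
  simp only [inert, dotProduct, Fin.sum_univ_three, cons_val]
  refine ((((h 0).mul ((h 0).const_mul i₁)).add ((h 1).mul ((h 1).const_mul i₁))).add
    ((h 2).mul ((h 2).const_mul i₃))).congr_deriv ?_
  ring

lemma HasDerivAt.dotProduct_self {w : ℝ → Fin 3 → ℝ} {w' : Fin 3 → ℝ} {t : ℝ}
    (hw : HasDerivAt w w' t) :
    HasDerivAt (fun s => w s ⬝ᵥ w s) (2 * (w t ⬝ᵥ w')) t := by
  simpa [inert, dotProduct, Fin.sum_univ_three] using hw.dotProduct_inert 1 1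

/-- Along every solution of the equations of motion satisfying the contact constraint
(v + ω×r, γ) = 0, the energy E = ½(ω, I·ω) + ½ m (v,v) + m g a γ₃ evolves according to
dE/dt = (F, v) + (M_f, ω), for arbitrary resistance force F, rolling resistance torque
M_f and normal reaction N. -/
theorem energy_evolution
    (R m a g i₁ i₃ : ℝ) (hR : 0 < R) (hm : 0 < m) (hg : 0 < g)
    (hi₁ : 0 < i₁) (hi₃ : 0 < i₃)
    (ω v γ ω' v' γ' F Mf : ℝ → Fin 3 → ℝ) (N : ℝ → ℝ) (r : ℝ → Fin 3 → ℝ)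
    (hω : ∀ t, HasDerivAt ω (ω' t) t)
    (hv : ∀ t, HasDerivAt v (v' t) t)
    (hγ : ∀ t, HasDerivAt γ (γ' t) t)
    (hγunit : ∀ t, γ t ⬝ᵥ γ t = 1)
    (hr : ∀ t, r t = (-R) • γ t - a • (![0, 0, 1] : Fin 3 → ℝ))
    -- equations of motion
    (heqv : ∀ t, m • v' t + m • cross3 (ω t) (v t)
      = N t • γ t + F t - (m * g) • γ t)
    (heqω : ∀ t, inert i₁ i₃ (ω' t) + cross3 (ω t) (inert i₁ i₃ (ω t))
      = N t • cross3 (r t) (γ t) + Mf t)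
    (heqγ : ∀ t, γ' t = cross3 (γ t) (ω t))
    -- contact constraint
    (hconstr : ∀ t, (v t + cross3 (ω t) (r t)) ⬝ᵥ γ t = 0)
    -- the energy
    (E : ℝ → ℝ)
    (hE : ∀ t, E t = (1/2) * (ω t ⬝ᵥ inert i₁ i₃ (ω t)) + (1/2) * m * (v t ⬝ᵥ v t)
      + m * g * a * γ t 2) :
    ∀ t : ℝ, HasDerivAt E (F t ⬝ᵥ v t + Mf t ⬝ᵥ ω t) t := by
  intro t
  have hderiv := (((hω t).dotProduct_inert i₁ i₃).const_mul (1 / 2)).add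
    ((hv t).dotProduct_self.const_mul (1 / 2 * m)) |>.add
    ((hasDerivAt_pi.1 (hγ t) 2).const_mul (m * g * a))
  rw [show E = _ from funext hE]
  refine hderiv.congr_deriv ?_
  have hv_eq := congrFun (heqv t)
  have hω_eq := congrFun (heqω t)
  have hγ_eq := congrFun (heqγ t) 2
  have hc := hconstr t
  have hv0 := hv_eq 0
  have hv1 := hv_eq 1
  have hv2 := hv_eq 2
  have hω0 := hω_eq 0
  have hω1 := hω_eq 1
  have hω2 := hω_eq 2
  clear hv_eq hω_eq
  simp only [hr, cross3, inert, dotProduct, Fin.sum_univ_three, Pi.add_apply, Pi.sub_apply,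
    Pi.smul_apply, smul_eq_mul, cons_val] at *
  linear_combination v t 0 * hv0 + v t 1 * hv1 + v t 2 * hv2 + ω t 0 * hω0 + ω t 1 * hω1
    + ω t 2 * hω2 + m * g * a * hγ_eq + (N t - m * g) * hc
end
end

section
/- (Proposition, case 1°.) If (M_f(t), r(t)) = 0 for all t, then the Jellett integral G = −(J(γ)·ω, r) is constant along every solution of the angular equations of motion, for an arbitrary normal reaction N(t) and an arbitrary rolling resistance force applied at the contact point. -/
open Matrix

noncomputable section

/-- Action of J(γ) = I + m·(r×γ)⊗(r×γ), where (u⊗u)·w = (u,w)·u. -/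
def Japp (m i₁ i₃ : ℝ) (r γ w : Fin 3 → ℝ) : Fin 3 → ℝ :=
  inert i₁ i₃ w + (m * (cross3 r γ ⬝ᵥ w)) • cross3 r γ

theorem cross3_dotProduct_left (u v : Fin 3 → ℝ) : cross3 u v ⬝ᵥ u = 0 := by
  simp [cross3, dotProduct, Fin.sum_univ_three]
  ring

/-- The rank-one part of `J(γ)` does not contribute to `(J(γ)·w, r)`. -/
theorem Japp_dotProduct (m i₁ i₃ : ℝ) (r γ w : Fin 3 → ℝ) :
    Japp m i₁ i₃ r γ w ⬝ᵥ r = inert i₁ i₃ w ⬝ᵥ r := by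
  rw [Japp, add_dotProduct, smul_dotProduct, cross3_dotProduct_left, smul_zero, add_zero]

/-- Power balance along `r`: the gyroscopic term is compensated by the rotation of `γ`. -/
theorem inert_dotProduct_balance {R a i₁ i₃ N : ℝ} {w w' γ M : Fin 3 → ℝ}
    (hw : inert i₁ i₃ w' + cross3 w (inert i₁ i₃ w)
      = N • cross3 ((-R) • γ - a • (![0, 0, 1] : Fin 3 → ℝ)) γ + M)
    (hM : M ⬝ᵥ ((-R) • γ - a • (![0, 0, 1] : Fin 3 → ℝ)) = 0) :
    R * (i₁ * (w' 0 * γ 0 + w 0 * cross3 γ w 0) + i₁ * (w' 1 * γ 1 + w 1 * cross3 γ w 1)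
      + i₃ * (w' 2 * γ 2 + w 2 * cross3 γ w 2)) + a * i₃ * w' 2 = 0 := by
  have h0 := congrFun hw 0
  have h1 := congrFun hw 1
  have h2 := congrFun hw 2
  simp [cross3, inert, dotProduct, Fin.sum_univ_three] at h0 h1 h2 hM ⊢
  linear_combination R * γ 0 * h0 + R * γ 1 * h1 + (R * γ 2 + a) * h2 - hM

/-- Case 1°: if (M_f, r) = 0 for all t, then the Jellett integral G = −(J(γ)·ω, r)
is constant along every solution of the angular equations of motion, for an arbitrary
normal reaction N and an arbitrary rolling resistance force applied at the contact point. -/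
theorem jellett_integral_conservation
    (R m a i₁ i₃ : ℝ) (hR : 0 < R) (hm : 0 < m) (hi₁ : 0 < i₁) (hi₃ : 0 < i₃)
    (ω γ ω' γ' Mf : ℝ → Fin 3 → ℝ) (N : ℝ → ℝ) (r : ℝ → Fin 3 → ℝ)
    (hω : ∀ t, HasDerivAt ω (ω' t) t)
    (hγ : ∀ t, HasDerivAt γ (γ' t) t)
    (hγunit : ∀ t, γ t ⬝ᵥ γ t = 1)
    (hr : ∀ t, r t = (-R) • γ t - a • (![0, 0, 1] : Fin 3 → ℝ))
    -- angular equations of motion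
    (heqω : ∀ t, inert i₁ i₃ (ω' t) + cross3 (ω t) (inert i₁ i₃ (ω t))
      = N t • cross3 (r t) (γ t) + Mf t)
    (heqγ : ∀ t, γ' t = cross3 (γ t) (ω t))
    -- the hypothesis of case 1°
    (hMf : ∀ t, Mf t ⬝ᵥ r t = 0)
    -- the Jellett integral
    (G : ℝ → ℝ)
    (hG : ∀ t, G t = -(Japp m i₁ i₃ (r t) (γ t) (ω t) ⬝ᵥ r t)) :
    ∀ t s : ℝ, G t = G s := by
  have hG' : G = fun t => R * (i₁ * (ω t 0 * γ t 0) + i₁ * (ω t 1 * γ t 1)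
      + i₃ * (ω t 2 * γ t 2)) + a * i₃ * ω t 2 := by
    funext t
    rw [hG, Japp_dotProduct, hr]
    simp [inert, dotProduct, Fin.sum_univ_three]
    ring
  have hderiv : ∀ t, HasDerivAt G 0 t := by
    intro t
    have hωc := hasDerivAt_pi.1 (hω t)
    have hγc := hasDerivAt_pi.1 (hγ t)
    have hb := inert_dotProduct_balance (hr t ▸ heqω t) (hr t ▸ hMf t)
    rw [hG']
    have hd := ((((((hωc 0).mul (hγc 0)).const_mul i₁).add
      (((hωc 1).mul (hγc 1)).const_mul i₁)).add
      (((hωc 2).mul (hγc 2)).const_mul i₃)).const_mul R).add ((hωc 2).const_mul (a * i₃))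
    refine hd.congr_deriv ?_
    rw [heqγ]
    exact hb
  exact is_const_of_deriv_eq_zero (fun t => (hderiv t).differentiableAt)
    fun t => (hderiv t).deriv
end
end

section
/- (Proposition, case 3°.) If (M_f(t), γ(t)) = 0 for all t, then the area integral C = (J(γ)·ω, γ) is constant along every solution of the angular equations of motion, for an arbitrary normal reaction N(t). -/
open Matrix

noncomputable section

/-- The rank-one part of `J` does not contribute to the area integral, as `r × γ ⟂ γ`. -/
lemma Japp_dotProduct_self (m i₁ i₃ : ℝ) (r γ w : Fin 3 → ℝ) :
    Japp m i₁ i₃ r γ w ⬝ᵥ γ = inert i₁ i₃ w ⬝ᵥ γ := by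
  simp [Japp, inert, cross3, dotProduct, Fin.sum_univ_three]
  ring

lemma hasDerivAt_inert_dotProduct (i₁ i₃ : ℝ) {ω γ : ℝ → Fin 3 → ℝ} {ω' γ' : Fin 3 → ℝ} {t : ℝ}
    (hω : HasDerivAt ω ω' t) (hγ : HasDerivAt γ γ' t) :
    HasDerivAt (fun s => inert i₁ i₃ (ω s) ⬝ᵥ γ s)
      (inert i₁ i₃ ω' ⬝ᵥ γ t + inert i₁ i₃ (ω t) ⬝ᵥ γ') t := by
  have h (c : ℝ) (k : Fin 3) :=
    ((hasDerivAt_pi.1 hω k).const_mul c).mul (hasDerivAt_pi.1 hγ k)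
  simp only [inert, dotProduct, Fin.sum_univ_three]
  refine (((h i₁ 0).add (h i₁ 1)).add (h i₃ 2)).congr_deriv ?_
  simp
  ring

/-- Euler's equations with a torque `n • (r × γ) + M` and `γ` fixed in space: only the vertical
component of `M` changes the vertical component of the angular momentum. -/
lemma inert_dotProduct_rate {i₁ i₃ n : ℝ} {r γ w w' M : Fin 3 → ℝ}
    (h : inert i₁ i₃ w' + cross3 w (inert i₁ i₃ w) = n • cross3 r γ + M) :
    inert i₁ i₃ w' ⬝ᵥ γ + inert i₁ i₃ w ⬝ᵥ cross3 γ w = M ⬝ᵥ γ := by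
  rw [show M = inert i₁ i₃ w' + cross3 w (inert i₁ i₃ w) - n • cross3 r γ by rw [h]; simp]
  simp [inert, cross3, dotProduct, Fin.sum_univ_three]
  ring

/-- Case 3°: if (M_f, γ) = 0 for all t, then the area integral C = (J(γ)·ω, γ) is
constant along every solution of the angular equations of motion, for an arbitrary
normal reaction N. -/
theorem area_integral_conservation
    (R m a i₁ i₃ : ℝ) (hR : 0 < R) (hm : 0 < m) (hi₁ : 0 < i₁) (hi₃ : 0 < i₃)
    (ω γ ω' γ' Mf : ℝ → Fin 3 → ℝ) (N : ℝ → ℝ) (r : ℝ → Fin 3 → ℝ)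
    (hω : ∀ t, HasDerivAt ω (ω' t) t)
    (hγ : ∀ t, HasDerivAt γ (γ' t) t)
    (hγunit : ∀ t, γ t ⬝ᵥ γ t = 1)
    (hr : ∀ t, r t = (-R) • γ t - a • (![0, 0, 1] : Fin 3 → ℝ))
    -- angular equations of motion
    (heqω : ∀ t, inert i₁ i₃ (ω' t) + cross3 (ω t) (inert i₁ i₃ (ω t))
      = N t • cross3 (r t) (γ t) + Mf t)
    (heqγ : ∀ t, γ' t = cross3 (γ t) (ω t))
    -- the hypothesis of case 3°
    (hMf : ∀ t, Mf t ⬝ᵥ γ t = 0)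
    -- the area integral
    (C : ℝ → ℝ)
    (hC : ∀ t, C t = Japp m i₁ i₃ (r t) (γ t) (ω t) ⬝ᵥ γ t) :
    ∀ t s : ℝ, C t = C s := by
  obtain rfl : C = fun t => inert i₁ i₃ (ω t) ⬝ᵥ γ t :=
    funext fun t => (hC t).trans (Japp_dotProduct_self ..)
  have hderiv (t : ℝ) : HasDerivAt (fun t => inert i₁ i₃ (ω t) ⬝ᵥ γ t) 0 t := by
    refine (hasDerivAt_inert_dotProduct i₁ i₃ (hω t) (hγ t)).congr_deriv ?_
    rw [heqγ, inert_dotProduct_rate (heqω t), hMf]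
  exact is_const_of_deriv_eq_zero (fun t => (hderiv t).differentiableAt) fun t => (hderiv t).deriv
end
end

section
/- (Generalization of case 3° to a dynamically asymmetric unbalanced ball.) Let I be an arbitrary symmetric positive-definite 3×3 matrix and a ∈ ℝ³ an arbitrary fixed body vector, and set r = −R·γ − a. If (M_f(t), γ(t)) = 0 for all t, then the area integral C = (I·ω, γ) is constant along every solution of I·ω̇ + ω×(I·ω) = N·(r×γ) + M_f, γ̇ = γ×ω, for an arbitrary normal reaction N(t). -/
open Matrix

noncomputable section

/-- Product rule for the dot product of two curves. -/
theorem HasDerivAt.dotProduct_curve {ι : Type*} [Fintype ι] {u v : ℝ → ι → ℝ} {u' v' : ι → ℝ}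
    {t : ℝ} (hu : HasDerivAt u u' t) (hv : HasDerivAt v v' t) :
    HasDerivAt (fun s => u s ⬝ᵥ v s) (u' ⬝ᵥ v t + u t ⬝ᵥ v') t := by
  simp only [dotProduct, ← Finset.sum_add_distrib]
  exact HasDerivAt.fun_sum fun i _ => (hasDerivAt_pi.1 hu i).mul (hasDerivAt_pi.1 hv i)

/-- A constant matrix commutes with differentiation of a curve. -/
theorem HasDerivAt.const_mulVec {ι κ : Type*} [Fintype ι] [Fintype κ] (A : Matrix κ ι ℝ)
    {u : ℝ → ι → ℝ} {u' : ι → ℝ} {t : ℝ} (hu : HasDerivAt u u' t) :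
    HasDerivAt (fun s => A.mulVec (u s)) (A.mulVec u') t :=
  (LinearMap.toContinuousLinearMap A.mulVecLin).hasFDerivAt.comp_hasDerivAt t hu

theorem cross3_dotProduct_right_self (u v : Fin 3 → ℝ) : cross3 u v ⬝ᵥ v = 0 := by
  simp [cross3, dotProduct, Fin.sum_univ_three]
  ring

theorem dotProduct_cross3 (u v w : Fin 3 → ℝ) : u ⬝ᵥ cross3 v w = cross3 w u ⬝ᵥ v := by
  simp [cross3, dotProduct, Fin.sum_univ_three]
  ring

/-- Generalization of case 3° to a dynamically asymmetric unbalanced ball: if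
(M_f, γ) = 0 for all t, then the area integral C = (I·ω, γ) is constant along every
solution of I·ω̇ + ω×(I·ω) = N·(r×γ) + M_f, γ̇ = γ×ω, for an arbitrary normal
reaction N, where I is an arbitrary symmetric positive-definite matrix and a an
arbitrary fixed body vector, r = −R·γ − a. -/
theorem area_integral_asymmetric_ball
    (R : ℝ) (hR : 0 < R)
    (I : Matrix (Fin 3) (Fin 3) ℝ) (hIsymm : I.IsSymm) (hIpos : I.PosDef)
    (a : Fin 3 → ℝ)
    (ω γ ω' γ' Mf : ℝ → Fin 3 → ℝ) (N : ℝ → ℝ) (r : ℝ → Fin 3 → ℝ)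
    (hω : ∀ t, HasDerivAt ω (ω' t) t)
    (hγ : ∀ t, HasDerivAt γ (γ' t) t)
    (hγunit : ∀ t, γ t ⬝ᵥ γ t = 1)
    (hr : ∀ t, r t = (-R) • γ t - a)
    -- angular equations of motion
    (heqω : ∀ t, I.mulVec (ω' t) + cross3 (ω t) (I.mulVec (ω t))
      = N t • cross3 (r t) (γ t) + Mf t)
    (heqγ : ∀ t, γ' t = cross3 (γ t) (ω t))
    -- the hypothesis of case 3°
    (hMf : ∀ t, Mf t ⬝ᵥ γ t = 0)
    -- the area integral
    (C : ℝ → ℝ)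
    (hC : ∀ t, C t = I.mulVec (ω t) ⬝ᵥ γ t) :
    ∀ t s : ℝ, C t = C s := by
  have hderiv : ∀ t, HasDerivAt C 0 t := by
    intro t
    have h := ((hω t).const_mulVec I).dotProduct_curve (hγ t)
    have hzero : I.mulVec (ω' t) ⬝ᵥ γ t + I.mulVec (ω t) ⬝ᵥ γ' t = 0 := by
      rw [heqγ, dotProduct_cross3, ← add_dotProduct, heqω, add_dotProduct, smul_dotProduct,
        cross3_dotProduct_right_self, hMf, smul_zero, add_zero]
    rw [hzero] at h
    rwa [funext hC]
  exact is_const_of_deriv_eq_zero (fun t => (hderiv t).differentiableAt)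
    fun t => (hderiv t).deriv
end
end

section
/- (Dissipativity of the horizontal rolling-resistance model.) Suppose F(t) = 0 and M_f(t) = −μ_r·ω_⊥(t) with μ_r > 0, where ω_⊥ = ω − (ω,γ)·γ, and suppose |γ(t)| = 1 and the contact constraint (v+ω×r, γ)=0 hold for all t. Then along every solution of the equations of motion the energy E = ½(ω, I·ω) + ½·m·(v,v) + m·g·a·γ₃ satisfies dE/dt = −μ_r·|ω_⊥|² ≤ 0. -/
open Matrix

noncomputable section

/-- Dissipativity of the horizontal rolling-resistance model: with F = 0 and
M_f = −μ_r·ω_⊥ where ω_⊥ = ω − (ω,γ)·γ, along every solution of the equations of motion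
(with |γ| = 1 and the contact constraint), the energy satisfies
dE/dt = −μ_r·|ω_⊥|² ≤ 0. -/
theorem horizontal_rolling_resistance_dissipative
    (R m a g i₁ i₃ μr : ℝ) (hR : 0 < R) (hm : 0 < m) (hg : 0 < g)
    (hi₁ : 0 < i₁) (hi₃ : 0 < i₃) (hμr : 0 < μr)
    (ω v γ ω' v' γ' Mf ωperp : ℝ → Fin 3 → ℝ) (N : ℝ → ℝ) (r : ℝ → Fin 3 → ℝ)
    (hω : ∀ t, HasDerivAt ω (ω' t) t)
    (hv : ∀ t, HasDerivAt v (v' t) t)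
    (hγ : ∀ t, HasDerivAt γ (γ' t) t)
    (hγunit : ∀ t, γ t ⬝ᵥ γ t = 1)
    (hr : ∀ t, r t = (-R) • γ t - a • (![0, 0, 1] : Fin 3 → ℝ))
    (hωperp : ∀ t, ωperp t = ω t - (ω t ⬝ᵥ γ t) • γ t)
    -- the friction model: F = 0 and M_f = −μ_r·ω_⊥
    (hMf : ∀ t, Mf t = (-μr) • ωperp t)
    -- equations of motion (with F = 0)
    (heqv : ∀ t, m • v' t + m • cross3 (ω t) (v t)
      = N t • γ t - (m * g) • γ t)
    (heqω : ∀ t, inert i₁ i₃ (ω' t) + cross3 (ω t) (inert i₁ i₃ (ω t))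
      = N t • cross3 (r t) (γ t) + Mf t)
    (heqγ : ∀ t, γ' t = cross3 (γ t) (ω t))
    -- contact constraint
    (hconstr : ∀ t, (v t + cross3 (ω t) (r t)) ⬝ᵥ γ t = 0)
    -- the energy
    (E : ℝ → ℝ)
    (hE : ∀ t, E t = (1/2) * (ω t ⬝ᵥ inert i₁ i₃ (ω t)) + (1/2) * m * (v t ⬝ᵥ v t)
      + m * g * a * γ t 2) :
    ∀ t : ℝ, HasDerivAt E (-μr * (ωperp t ⬝ᵥ ωperp t)) t ∧
      -μr * (ωperp t ⬝ᵥ ωperp t) ≤ 0 := by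
  intro t
  refine ⟨?_, by
    have h : 0 ≤ ωperp t ⬝ᵥ ωperp t :=
      Finset.sum_nonneg fun i _ => mul_self_nonneg (ωperp t i)
    nlinarith⟩
  have dω := fun i => hasDerivAt_pi.1 (hω t) i
  have dv := fun i => hasDerivAt_pi.1 (hv t) i
  have dγ := hasDerivAt_pi.1 (hγ t) 2
  have hE' : E = fun s =>
      (1/2) * (i₁ * (ω s 0 * ω s 0) + i₁ * (ω s 1 * ω s 1) + i₃ * (ω s 2 * ω s 2))
      + (1/2) * m * (v s 0 * v s 0 + v s 1 * v s 1 + v s 2 * v s 2)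
      + m * g * a * γ s 2 := by
    funext s
    rw [hE s]
    simp [dotProduct, Fin.sum_univ_three, inert]
    ring
  rw [hE']
  have hderiv := (((((((dω 0).mul (dω 0)).const_mul i₁).add
      (((dω 1).mul (dω 1)).const_mul i₁)).add
      (((dω 2).mul (dω 2)).const_mul i₃)).const_mul (1/2)).add
      (((((dv 0).mul (dv 0)).add ((dv 1).mul (dv 1))).add
      ((dv 2).mul (dv 2))).const_mul ((1/2) * m))).add (dγ.const_mul (m * g * a))
  refine hderiv.congr_deriv ?_
  have eγ := congrFun (heqγ t) 2
  have ev := fun i => congrFun (heqv t) i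
  have eω := fun i => congrFun (heqω t) i
  have ev0 := ev 0
  have ev1 := ev 1
  have ev2 := ev 2
  have eω0 := eω 0
  have eω1 := eω 1
  have eω2 := eω 2
  have hc := hconstr t
  have hu := hγunit t
  simp only [hMf, hωperp, hr, cross3, inert, dotProduct, Fin.sum_univ_three, Pi.add_apply,
    Pi.sub_apply, Pi.smul_apply, smul_eq_mul, cons_val_zero, cons_val_one, cons_val]
    at eγ ev0 ev1 ev2 eω0 eω1 eω2 hc hu ⊢
  linear_combination ω t 0 * eω0 + ω t 1 * eω1 + ω t 2 * eω2
    + v t 0 * ev0 + v t 1 * ev1 + v t 2 * ev2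
    + m * g * a * eγ + (N t - m * g) * hc
    + μr * (ω t 0 * γ t 0 + ω t 1 * γ t 1 + ω t 2 * γ t 2) ^ 2 * hu
end
end

section
/- (Permanent rotations σ₀ are fixed points of the reduced system.) Let i₁ ≠ i₃, a > 0, and let c₁ ∈ ℝ satisfy c₁² > a/|i₁−i₃|. Set γ₃ = −a/(c₁²·(i₁−i₃)), K₁ = a·i₃/(c₁·(i₁−i₃)), K₂ = 0, and C = −c₁·i₁ + a²/(c₁³·(i₁−i₃)). Then γ₃ ∈ (−1,1) and the right-hand side of the reduced tippe top system with area-integral value C vanishes at the point (γ₃, K₁, K₂). -/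
noncomputable section

/-- Permanent rotations σ₀ are fixed points of the reduced tippe top system: for
i₁ ≠ i₃, a > 0 and c₁² > a/|i₁−i₃|, the point γ₃ = −a/(c₁²(i₁−i₃)),
K₁ = a·i₃/(c₁(i₁−i₃)), K₂ = 0, with area-integral value
C = −c₁·i₁ + a²/(c₁³(i₁−i₃)), satisfies γ₃ ∈ (−1,1) and annihilates the right-hand
side of the reduced system. -/
theorem permanent_rotations_are_fixed_points
    (a μr i₁ i₃ c₁ : ℝ) (ha : 0 < a) (hμr : 0 < μr) (hi₁ : 0 < i₁) (hi₃ : 0 < i₃)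
    (hne : i₁ ≠ i₃) (hc₁ : a / |i₁ - i₃| < c₁ ^ 2)
    (γ₃ K₁ K₂ C k ktil : ℝ)
    (hγ₃ : γ₃ = -a / (c₁ ^ 2 * (i₁ - i₃)))
    (hK₁ : K₁ = a * i₃ / (c₁ * (i₁ - i₃)))
    (hK₂ : K₂ = 0)
    (hC : C = -c₁ * i₁ + a ^ 2 / (c₁ ^ 3 * (i₁ - i₃)))
    (hk : k = Real.sqrt ((1 - γ₃ ^ 2) / (i₁ + a ^ 2 * (1 - γ₃ ^ 2))))
    (hktil : ktil = (i₁ - (i₁ - i₃) * γ₃ ^ 2) / i₃) :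
    γ₃ ∈ Set.Ioo (-1 : ℝ) 1 ∧
    k * K₂ = 0 ∧
    -(μr / i₁) * (K₁ * ktil - γ₃ * C) = 0 ∧
    -(k * (C - γ₃ * K₁) * (C * γ₃ - K₁)) / (i₁ * (1 - γ₃ ^ 2) ^ 2)
      - k * a - μr * K₂ * k ^ 2 / (1 - γ₃ ^ 2) = 0 := by
  have hd : i₁ - i₃ ≠ 0 := sub_ne_zero.mpr hne
  have hdpos : 0 < |i₁ - i₃| := abs_pos.mpr hd
  have hc2 : 0 < c₁ ^ 2 := (div_pos ha hdpos).trans hc₁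
  have hc : c₁ ≠ 0 := by
    rintro rfl
    simp at hc2
  have habs : |γ₃| < 1 := by
    rw [hγ₃, abs_div, abs_neg, abs_mul, abs_of_pos ha, abs_of_pos hc2,
      div_lt_one (mul_pos hc2 hdpos)]
    exact (div_lt_iff₀ hdpos).mp hc₁
  have hγ : γ₃ ∈ Set.Ioo (-1 : ℝ) 1 := abs_lt.mp habs
  have hs : 1 - γ₃ ^ 2 ≠ 0 := by nlinarith [hγ.1, hγ.2]
  have ha' : a = -(γ₃ * c₁ ^ 2 * (i₁ - i₃)) := by
    rw [hγ₃]
    field_simp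
  have hK₁' : K₁ = -(γ₃ * c₁ * i₃) := by
    rw [hK₁, hγ₃]
    field_simp
  have hC' : C = -c₁ * i₁ + γ₃ ^ 2 * c₁ * (i₁ - i₃) := by
    rw [hC, hγ₃]
    field_simp
  have hmul : K₁ * ktil = γ₃ * C := by
    rw [hK₁', hktil, hC']
    field_simp
    ring
  have hleft : C - γ₃ * K₁ = -(c₁ * i₁ * (1 - γ₃ ^ 2)) := by
    rw [hC', hK₁']
    ring
  have hright : C * γ₃ - K₁ = -(γ₃ * c₁ * (i₁ - i₃) * (1 - γ₃ ^ 2)) := by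
    rw [hC', hK₁']
    ring
  have hgyro : -(k * (C - γ₃ * K₁) * (C * γ₃ - K₁)) / (i₁ * (1 - γ₃ ^ 2) ^ 2) = k * a := by
    rw [hleft, hright, div_eq_iff (mul_ne_zero hi₁.ne' (pow_ne_zero 2 hs)), ha']
    ring
  refine ⟨hγ, by rw [hK₂, mul_zero], by rw [hmul, sub_self, mul_zero], ?_⟩
  rw [hgyro, hK₂]
  simp
end
end

section
/- (Critical value of the area integral.) Let a > 0, i₁,i₃ > 0 with i₁ ≠ i₃, and define C(c₁) = −c₁·i₁ + a²/(c₁³·(i₁−i₃)) and γ₃(c₁) = −a/(c₁²·(i₁−i₃)) for c₁ ≠ 0, and c₀ = √(a/|i₁−i₃|). Then γ₃(±c₀)² = 1 and C(±c₀) = ∓ i₃·√(a/|i₁−i₃|); in particular |C(±c₀)| = C* where C* = i₃·√(a/|i₁−i₃|) is the critical value at which the family of permanent rotations arises. -/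
noncomputable section

/-- Critical value of the area integral: with C(c₁) = −c₁·i₁ + a²/(c₁³(i₁−i₃)) and
γ₃(c₁) = −a/(c₁²(i₁−i₃)) for c₁ ≠ 0, and c₀ = √(a/|i₁−i₃|), one has γ₃(±c₀)² = 1 and
C(±c₀) = ∓ i₃·√(a/|i₁−i₃|); in particular |C(±c₀)| = C* where C* = i₃·√(a/|i₁−i₃|). -/
theorem critical_value_of_area_integral
    (a i₁ i₃ : ℝ) (ha : 0 < a) (hi₁ : 0 < i₁) (hi₃ : 0 < i₃) (hne : i₁ ≠ i₃)
    (C γ₃ : ℝ → ℝ) (c₀ Cstar : ℝ)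
    (hC : ∀ c₁ : ℝ, c₁ ≠ 0 → C c₁ = -c₁ * i₁ + a ^ 2 / (c₁ ^ 3 * (i₁ - i₃)))
    (hγ₃ : ∀ c₁ : ℝ, c₁ ≠ 0 → γ₃ c₁ = -a / (c₁ ^ 2 * (i₁ - i₃)))
    (hc₀ : c₀ = Real.sqrt (a / |i₁ - i₃|))
    (hCstar : Cstar = i₃ * Real.sqrt (a / |i₁ - i₃|)) :
    γ₃ c₀ ^ 2 = 1 ∧ γ₃ (-c₀) ^ 2 = 1 ∧
    C c₀ = -(i₃ * Real.sqrt (a / |i₁ - i₃|)) ∧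
    C (-c₀) = i₃ * Real.sqrt (a / |i₁ - i₃|) ∧
    |C c₀| = Cstar ∧ |C (-c₀)| = Cstar := by
  have hd : i₁ - i₃ ≠ 0 := sub_ne_zero.mpr hne
  have hd' : 0 < |i₁ - i₃| := abs_pos.mpr hd
  have hc_pos : 0 < c₀ := hc₀ ▸ Real.sqrt_pos.mpr (div_pos ha hd')
  have hc : c₀ ≠ 0 := hc_pos.ne'
  have hsq : c₀ ^ 2 * |i₁ - i₃| = a := by
    rw [hc₀, Real.sq_sqrt (div_pos ha hd').le, div_mul_cancel₀ _ hd'.ne']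
  have ha2 : a ^ 2 = c₀ ^ 4 * (i₁ - i₃) ^ 2 := by
    rw [← hsq, mul_pow, sq_abs]
    ring
  have hγ : γ₃ c₀ ^ 2 = 1 := by
    rw [hγ₃ c₀ hc, div_pow, neg_sq, ha2]
    field_simp
  have hγ' : γ₃ (-c₀) ^ 2 = 1 := by
    rw [hγ₃ _ (neg_ne_zero.mpr hc), neg_sq, ← hγ₃ c₀ hc, hγ]
  have hCc : C c₀ = -(i₃ * c₀) := by
    rw [hC c₀ hc, ha2]
    field_simp
    ring
  have hCc' : C (-c₀) = i₃ * c₀ := by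
    rw [hC _ (neg_ne_zero.mpr hc), ha2, Odd.neg_pow (by decide)]
    field_simp
    ring
  have hpos : 0 < i₃ * c₀ := mul_pos hi₃ hc_pos
  rw [hCstar, ← hc₀]
  exact ⟨hγ, hγ', hCc, hCc', by rw [hCc, abs_neg, abs_of_pos hpos],
    by rw [hCc', abs_of_pos hpos]⟩
end
end

section
/- (Linear stability of permanent rotations σ₀ for i₁ > i₃.) Let a>0, μ_r>0, 0 < i₃ < i₁, and c₂ ∈ (−1,0). Then every complex root of the cubic a₀λ³ + a₁λ² + a₂λ + a₃ = 0 has strictly negative real part, where a₀ = −i₁·i₃·c₂·(i₁−i₃)·(i₁+a²(1−c₂²)), a₁ = −μ_r·c₂·(i₁−i₃)·(i₁·i₃·(1+c₂²) + (i₁²+i₁·a² − a²·c₂²·(i₁−i₃))·(1−c₂²)), a₂ = −μ_r²·c₂·(i₁−i₃)·(i₁−c₂²·(i₁−i₃)) + a·i₃·(i₁² + c₂²·(i₁−i₃)·(3i₁+i₃)), a₃ = a·μ_r·(i₁−i₃)·(1−c₂²)·(i₁+3c₂²·(i₁−i₃)). -/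
noncomputable section

/-- Sufficiency of the Routh–Hurwitz criterion for real cubics. -/
theorem re_neg_of_cubic_eq_zero {a₀ a₁ a₂ a₃ : ℝ} (h₀ : 0 < a₀) (h₁ : 0 < a₁) (h₂ : 0 < a₂)
    (h₃ : 0 < a₃) (h : a₀ * a₃ < a₁ * a₂) (z : ℂ)
    (hz : (a₀ : ℂ) * z ^ 3 + (a₁ : ℂ) * z ^ 2 + (a₂ : ℂ) * z + (a₃ : ℂ) = 0) : z.re < 0 := by
  obtain ⟨x, y⟩ := z
  have hre : a₀ * (x ^ 3 - 3 * x * y ^ 2) + a₁ * (x ^ 2 - y ^ 2) + a₂ * x + a₃ = 0 := by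
    have := congrArg Complex.re hz
    simp [pow_succ] at this
    linear_combination this
  have him : y * (a₀ * (3 * x ^ 2 - y ^ 2) + 2 * a₁ * x + a₂) = 0 := by
    have := congrArg Complex.im hz
    simp [pow_succ] at this
    linear_combination this
  change x < 0
  by_contra! hx
  rcases mul_eq_zero.mp him with rfl | hy
  · have : 0 < a₀ * x ^ 3 + a₁ * x ^ 2 + a₂ * x + a₃ := by positivity
    linarith
  · have key : 8 * a₀ ^ 2 * x ^ 3 + 8 * a₀ * a₁ * x ^ 2 + (2 * a₀ * a₂ + 2 * a₁ ^ 2) * x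
        + (a₁ * a₂ - a₀ * a₃) = 0 := by
      linear_combination (3 * a₀ * x + a₁) * hy - a₀ * hre
    have : 0 ≤ 8 * a₀ ^ 2 * x ^ 3 + 8 * a₀ * a₁ * x ^ 2 + (2 * a₀ * a₂ + 2 * a₁ ^ 2) * x := by
      positivity
    linarith

/-- Linear stability of permanent rotations σ₀ for i₁ > i₃: for a > 0, μ_r > 0,
0 < i₃ < i₁ and c₂ ∈ (−1,0), every complex root of the characteristic cubic
a₀λ³ + a₁λ² + a₂λ + a₃ = 0 of the linearization of the reduced system at σ₀ has
strictly negative real part. -/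
theorem permanent_rotations_stability
    (a μr i₁ i₃ c₂ : ℝ) (ha : 0 < a) (hμr : 0 < μr) (hi₃ : 0 < i₃) (h31 : i₃ < i₁)
    (hc₂ : c₂ ∈ Set.Ioo (-1 : ℝ) 0)
    (a₀ a₁ a₂ a₃ : ℝ)
    (ha₀ : a₀ = -i₁ * i₃ * c₂ * (i₁ - i₃) * (i₁ + a ^ 2 * (1 - c₂ ^ 2)))
    (ha₁ : a₁ = -μr * c₂ * (i₁ - i₃) * (i₁ * i₃ * (1 + c₂ ^ 2)
      + (i₁ ^ 2 + i₁ * a ^ 2 - a ^ 2 * c₂ ^ 2 * (i₁ - i₃)) * (1 - c₂ ^ 2)))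
    (ha₂ : a₂ = -μr ^ 2 * c₂ * (i₁ - i₃) * (i₁ - c₂ ^ 2 * (i₁ - i₃))
      + a * i₃ * (i₁ ^ 2 + c₂ ^ 2 * (i₁ - i₃) * (3 * i₁ + i₃)))
    (ha₃ : a₃ = a * μr * (i₁ - i₃) * (1 - c₂ ^ 2) * (i₁ + 3 * c₂ ^ 2 * (i₁ - i₃))) :
    ∀ z : ℂ, (a₀ : ℂ) * z ^ 3 + (a₁ : ℂ) * z ^ 2 + (a₂ : ℂ) * z + (a₃ : ℂ) = 0 →
      z.re < 0 := by
  obtain ⟨hc, hc0⟩ := hc₂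
  obtain ⟨p, rfl⟩ : ∃ p, c₂ = -p := ⟨-c₂, (neg_neg c₂).symm⟩
  obtain ⟨d, rfl⟩ : ∃ d, i₁ = i₃ + d := ⟨i₁ - i₃, by ring⟩
  have hp : 0 < p := by linarith
  have hd : 0 < d := by linarith
  obtain ⟨q, hq⟩ : ∃ q, q = 1 - p ^ 2 := ⟨_, rfl⟩
  have hq0 : 0 < q := by rw [hq]; nlinarith
  have e₀ : a₀ = (i₃ + d) * i₃ * p * d * ((i₃ + d) + a ^ 2 * q) := by rw [ha₀, hq]; ring
  have e₁ : a₁ = μr * p * d * ((i₃ + d) * q * ((i₃ + d) + a ^ 2 * q)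
      + ((i₃ + d) * i₃ * (1 + p ^ 2) + a ^ 2 * q * p ^ 2 * i₃)) := by rw [ha₁, hq]; ring
  have e₂ : a₂ = a * i₃ * (d * ((i₃ + d) + 3 * p ^ 2 * d))
      + (μr ^ 2 * p * d * (i₃ + d * q)
        + a * i₃ * (i₃ * (i₃ + d) + p ^ 2 * d * (4 * i₃))) := by rw [ha₂, hq]; ring
  have e₃ : a₃ = a * μr * d * q * ((i₃ + d) + 3 * p ^ 2 * d) := by rw [ha₃, hq]; ring
  apply re_neg_of_cubic_eq_zero
  · rw [e₀]; positivity
  · rw [e₁]; positivity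
  · rw [e₂]; positivity
  · rw [e₃]; positivity
  · calc a₀ * a₃ = (μr * p * d * ((i₃ + d) * q * ((i₃ + d) + a ^ 2 * q)))
          * (a * i₃ * (d * ((i₃ + d) + 3 * p ^ 2 * d))) := by rw [e₀, e₃]; ring
      _ < a₁ * a₂ := by
        rw [e₁, e₂]
        apply mul_lt_mul''
        · gcongr
          exact lt_add_of_pos_right _ (by positivity)
        · exact lt_add_of_pos_right _ (by positivity)
        · positivity
        · positivity
end
end
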